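/- Let (E_n) be a sequence of linear operators on a finite-dimensional Banach space and P a (not necessarily Hermitian) projection. Suppose (1) ‖PE_n − E_nP‖ ≤ c/n for some c and all large n; (2) there exist M ≥ 0, n₀ such that ‖(PE_nP)^k‖ ≤ M for all k ∈ ℕ and n ≥ n₀; (3) there exist K ≥ 0, μ ∈ [0,1), n₀ such that ‖(E_n − PE_nP)^k‖ ≤ Kμ^k for all k ∈ ℕ and n ≥ n₀. Then ‖E_n^n − (PE_nP)^n‖ = O(1/n) as n → ∞; explicitly, it is bounded by M[(1 + (K/(1−μ))C_n)² e^{(MK/(1−μ)) n C_n²} − 1] + Kμⁿ, where C_n = max{‖E_n'P‖, ‖PE_n'‖} with E_n' = E_n − PE_nP. -/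

import Mathlib

open Finset in
theorem ap_geom (μ : ℝ) (h0 : 0 ≤ μ) (h1 : μ < 1) (n : ℕ) :
    ∑ l ∈ range n, μ ^ l ≤ 1 / (1 - μ) := by
  rw [one_div, ← tsum_geometric_of_lt_one h0 h1]
  exact (summable_geometric_of_lt_one h0 h1).sum_le_tsum _ (fun i _ => pow_nonneg h0 i)

/-- Sum of words of length `m+1` in `A`, `B` starting and ending with `A`. -/
def apU {R : Type*} [Ring R] (A E : R) : ℕ → R
  | 0 => A
  | m + 1 => A * E ^ m * A

open Finset in
theorem ap_a {R : Type*} [Ring R] (A B : R) (i : ℕ) :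
    (A + B) ^ i * A = ∑ l ∈ range (i + 1), B ^ l * apU A (A + B) (i - l) := by
  induction i with
  | zero => simp [apU]
  | succ i ih =>
    rw [sum_range_succ']
    have : (A + B) ^ (i + 1) * A = B * ((A + B) ^ i * A) + A * (A + B) ^ i * A := by
      rw [pow_succ']; noncomm_ring
    rw [this, ih, mul_sum]
    simp [apU, pow_succ', mul_assoc]

open Finset in
theorem ap_b {R : Type*} [Ring R] (A B : R) (n : ℕ) :
    (A + B) ^ n = B ^ n + ∑ j ∈ range n, (A + B) ^ (n - 1 - j) * A * B ^ j := by
  induction n with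
  | zero => simp
  | succ n ih =>
    rw [sum_range_succ']
    have h : (A + B) ^ (n + 1) = (A + B) ^ n * A + (A + B) ^ n * B := by
      rw [pow_succ, mul_add]
    rw [h]
    nth_rewrite 2 [ih]
    rw [add_mul, sum_mul]
    have : ∀ j, n + 1 - 1 - (j + 1) = n - 1 - j := by intro j; omega
    simp only [this, pow_succ, mul_assoc]
    simp
    abel

open Finset in
def apD {R : Type*} [Ring R] (A B P : R) (m : ℕ) : R :=
  ∑ l ∈ range m, P * B ^ (l + 1) * apU A (A + B) (m - 1 - l)

open Finset in
theorem ap_c {R : Type*} [Ring R] (A B P : R) (hAP : A * P = A) (m : ℕ) :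
    apU A (A + B) (m + 1) = A * apU A (A + B) m + A * apD A B P m := by
  have : apU A (A + B) (m + 1) = A * ((A + B) ^ m * A) := by simp [apU, mul_assoc]
  rw [this, ap_a, sum_range_succ', mul_add, add_comm]
  congr 1
  · simp
  · rw [apD, mul_sum, mul_sum]
    refine sum_congr rfl fun l _ => ?_
    rw [← mul_assoc, ← mul_assoc, ← mul_assoc, hAP]
    congr 2
    omega

open Finset in
theorem ap_d {R : Type*} [Ring R] (A B P : R) (hAP : A * P = A) (m : ℕ) :
    apU A (A + B) m = A ^ (m + 1) + ∑ i ∈ range m, A ^ (m - i) * apD A B P i := by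
  induction m with
  | zero => simp [apU]
  | succ m ih =>
    rw [ap_c A B P hAP, ih, sum_range_succ, mul_add, mul_sum, pow_succ' A (m + 1), add_assoc]
    congr 2
    · refine sum_congr rfl fun i hi => ?_
      have : i < m := mem_range.1 hi
      rw [← mul_assoc, ← pow_succ']
      congr 2
      omega
    · simp

theorem ap_PU {R : Type*} [Ring R] (A E P : R) (hPA : P * A = A) (m : ℕ) :
    P * apU A E m = apU A E m := by
  cases m <;> simp [apU, ← mul_assoc, hPA]

section
open Finset
variable {R : Type*} [NormedRing R] (A B P : R) (hP : P * P = P) (hAP : A * P = A)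
  (hPA : P * A = A) (hPBP : P * B * P = 0)
  (M K μ C : ℝ) (hM : 0 ≤ M) (hK : 0 ≤ K) (hμ0 : 0 ≤ μ) (hμ1 : μ < 1) (hC : 0 ≤ C)
  (h2 : ∀ k : ℕ, ‖A ^ k‖ ≤ M) (h3 : ∀ k : ℕ, ‖B ^ k‖ ≤ K * μ ^ k)
  (hBP : ‖B * P‖ ≤ C) (hPB : ‖P * B‖ ≤ C)

include hPA hPBP hK hμ0 hμ1 hC h3 hBP hPB in
theorem ap_Dle (m : ℕ) (g : ℝ) (hg : 0 ≤ g) (hU : ∀ i < m, ‖apU A (A + B) i‖ ≤ g) :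
    ‖apD A B P m‖ ≤ (K / (1 - μ) * C ^ 2) * g := by
  cases m with
  | zero =>
    have : 0 ≤ K / (1 - μ) := div_nonneg hK (by linarith)
    simp [apD]; positivity
  | succ m =>
    rw [apD, sum_range_succ']
    have h0 : P * B ^ (0 + 1) * apU A (A + B) (m + 1 - 1 - 0) = 0 := by
      rw [← ap_PU A (A + B) P hPA, ← mul_assoc]; simp [hPBP]
    rw [h0, add_zero]
    calc _ ≤ ∑ l ∈ range m, (C * (K * μ ^ l) * C) * g := by
          refine norm_sum_le_of_le _ fun l hl => ?_
          have hl' := mem_range.1 hl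
          have : P * B ^ (l + 1 + 1) * apU A (A + B) (m + 1 - 1 - (l + 1))
              = (P * B) * B ^ l * (B * P) * apU A (A + B) (m + 1 - 1 - (l + 1)) := by
            conv_lhs => rw [← ap_PU A (A + B) P hPA]
            rw [pow_succ, pow_succ']; simp only [mul_assoc]
          rw [this]
          refine (norm_mul_le _ _).trans ?_
          gcongr
          · refine (norm_mul_le _ _).trans ?_
            gcongr
            refine (norm_mul_le _ _).trans ?_
            gcongr
            exact h3 l
          · exact hU _ (by omega)
      _ = (K * C ^ 2 * g) * ∑ l ∈ range m, μ ^ l := by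
          rw [mul_sum]; exact sum_congr rfl fun l _ => by ring
      _ ≤ (K * C ^ 2 * g) * (1 / (1 - μ)) := by
          gcongr; exact ap_geom μ hμ0 hμ1 m
      _ = _ := by ring

include hAP hPA hPBP hM hK hμ0 hμ1 hC h2 h3 hBP hPB in
theorem ap_Uall (m : ℕ) :
    ‖apU A (A + B) m - A ^ (m + 1)‖ ≤ M * ((1 + M * (K / (1 - μ) * C ^ 2)) ^ m - 1) ∧
    ‖apU A (A + B) m‖ ≤ M * (1 + M * (K / (1 - μ) * C ^ 2)) ^ m := by
  have hq : 0 ≤ K / (1 - μ) * C ^ 2 := mul_nonneg (div_nonneg hK (by linarith)) (sq_nonneg C)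
  induction m using Nat.strong_induction_on with
  | _ m ih =>
  set q := K / (1 - μ) * C ^ 2 with hqd
  have key : ‖apU A (A + B) m - A ^ (m + 1)‖ ≤ M * ((1 + M * q) ^ m - 1) := by
    rw [ap_d A B P hAP, add_sub_cancel_left]
    calc _ ≤ ∑ i ∈ range m, M * (q * (M * (1 + M * q) ^ i)) := by
          refine norm_sum_le_of_le _ fun i hi => ?_
          refine (norm_mul_le _ _).trans ?_
          gcongr
          · exact h2 _
          · refine ap_Dle A B P hPA hPBP K μ C hK hμ0 hμ1 hC h3 hBP hPB i _ (by positivity) ?_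
            intro j hj
            refine (ih j (hj.trans (mem_range.1 hi))).2.trans ?_
            gcongr
            nlinarith [mul_nonneg hM hq]
      _ = M * ((∑ i ∈ range m, (1 + M * q) ^ i) * ((1 + M * q) - 1)) := by
          rw [sum_mul, mul_sum]; exact sum_congr rfl fun l _ => by ring
      _ = _ := by rw [geom_sum_mul]
  refine ⟨key, ?_⟩
  have := norm_add_le (apU A (A + B) m - A ^ (m + 1)) (A ^ (m + 1))
  rw [sub_add_cancel] at this
  linarith [h2 (m + 1)]

include hAP hPA hPBP hM hK hμ0 hμ1 hC h2 h3 hBP hPB in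
theorem ap_main (n : ℕ) :
    ‖(A + B) ^ n - A ^ n‖ ≤ M * ((1 + K / (1 - μ) * C) ^ 2 *
      Real.exp (M * K / (1 - μ) * n * C ^ 2) - 1) + K * μ ^ n := by
  have ha : 0 ≤ K / (1 - μ) := div_nonneg hK (by linarith)
  have hq : 0 ≤ K / (1 - μ) * C ^ 2 := mul_nonneg ha (sq_nonneg C)
  have hUall := ap_Uall A B P hAP hPA hPBP M K μ C hM hK hμ0 hμ1 hC h2 h3 hBP hPB
  cases n with
  | zero =>
    have : 0 ≤ K / (1 - μ) * C := mul_nonneg ha hC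
    simp
    have h : 0 ≤ M * ((1 + K / (1 - μ) * C) ^ 2 - 1) := mul_nonneg hM (by nlinarith)
    linarith
  | succ k =>
  set s := K / (1 - μ) * C with hs
  have hs0 : 0 ≤ s := mul_nonneg ha hC
  set y := 1 + M * (K / (1 - μ) * C ^ 2) with hy
  have hy1 : 1 ≤ y := by nlinarith [mul_nonneg hM hq]
  set G := M * y ^ k with hG
  have hG0 : 0 ≤ G := by positivity
  have hUG : ∀ i ≤ k, ‖apU A (A + B) i‖ ≤ G := fun i hi =>
    (hUall i).2.trans (by rw [hG]; gcongr)
  have hsum : ∀ N, ∑ l ∈ range N, (K * μ ^ l) * C ≤ s := fun N => by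
    rw [← sum_mul, ← mul_sum, hs, div_eq_mul_one_div]
    gcongr
    exact ap_geom μ hμ0 hμ1 N
  -- left ends
  have hL : ∀ i ≤ k, ‖(A + B) ^ i * A - apU A (A + B) i‖ ≤ s * G := fun i hi => by
    rw [ap_a, sum_range_succ']
    simp only [pow_zero, one_mul, Nat.sub_zero, add_sub_cancel_right]
    calc _ ≤ ∑ l ∈ range i, ((K * μ ^ l) * C) * G := by
          refine norm_sum_le_of_le _ fun l hl => ?_
          rw [← ap_PU A (A + B) P hPA]
          have : B ^ (l + 1) * (P * apU A (A + B) (i - (l + 1)))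
            = B ^ l * (B * P) * apU A (A + B) (i - (l + 1)) := by
            rw [pow_succ]; simp only [mul_assoc]
          rw [this]
          refine (norm_mul_le _ _).trans ?_
          gcongr
          · refine (norm_mul_le _ _).trans ?_
            gcongr
            exact h3 l
          · exact hUG _ (by omega)
      _ ≤ s * G := by rw [← sum_mul]; gcongr; exact hsum i
  have hL2 : ∀ i ≤ k, ‖(A + B) ^ i * A‖ ≤ (1 + s) * G := fun i hi => by
    have := norm_add_le ((A + B) ^ i * A - apU A (A + B) i) (apU A (A + B) i)
    rw [sub_add_cancel] at this
    linarith [hL i hi, hUG i hi]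
  have hR : ‖∑ j ∈ range k, (A + B) ^ (k - (j + 1)) * A * B ^ (j + 1)‖ ≤ (1 + s) * G * s := by
    calc _ ≤ ∑ l ∈ range k, ((1 + s) * G) * ((K * μ ^ l) * C) := by
          refine norm_sum_le_of_le _ fun l hl => ?_
          have : (A + B) ^ (k - (l + 1)) * A * B ^ (l + 1)
            = ((A + B) ^ (k - (l + 1)) * A) * ((P * B) * B ^ l) := by
            conv_lhs => rw [← hAP]
            rw [pow_succ']; simp only [mul_assoc]
            congr 2
            simp only [← mul_assoc, hAP]
          rw [this]
          refine (norm_mul_le _ _).trans ?_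
          gcongr
          · exact hL2 _ (by omega)
          · refine (norm_mul_le _ _).trans ?_
            rw [mul_comm (K * μ ^ l)]
            gcongr
            exact h3 l
      _ ≤ _ := by rw [← mul_sum]; gcongr; exact hsum k
  have hdec : (A + B) ^ (k + 1) - A ^ (k + 1) = B ^ (k + 1)
      + (∑ j ∈ range k, (A + B) ^ (k - (j + 1)) * A * B ^ (j + 1))
      + ((A + B) ^ k * A - apU A (A + B) k) + (apU A (A + B) k - A ^ (k + 1)) := by
    rw [ap_b A B (k + 1), sum_range_succ']
    simp only [Nat.add_sub_cancel, pow_zero, mul_one, Nat.sub_zero]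
    abel
  have hexp : y ^ k ≤ Real.exp (M * K / (1 - μ) * ((k + 1 : ℕ) : ℝ) * C ^ 2) := by
    calc y ^ k ≤ y ^ (k + 1) := pow_le_pow_right₀ hy1 (by omega)
      _ ≤ (Real.exp (M * (K / (1 - μ) * C ^ 2))) ^ (k + 1) := by
          gcongr
          rw [hy, add_comm]; exact Real.add_one_le_exp _
      _ = _ := by rw [← Real.exp_nat_mul]; congr 1; ring
  have hfin : (1 + s) ^ 2 * G ≤
      M * ((1 + s) ^ 2 * Real.exp (M * K / (1 - μ) * ((k + 1 : ℕ) : ℝ) * C ^ 2)) := by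
    rw [hG, mul_left_comm]; gcongr
  rw [hdec]
  have t1 := norm_add₄_le (a := B ^ (k + 1))
      (b := ∑ j ∈ range k, (A + B) ^ (k - (j + 1)) * A * B ^ (j + 1))
      (c := (A + B) ^ k * A - apU A (A + B) k) (d := apU A (A + B) k - A ^ (k + 1))
  have t2 := h3 (k + 1)
  have t3 := hL k le_rfl
  have t4 := (hUall k).1
  have t5 : M * (y ^ k - 1) = G - M := by rw [hG]; ring
  nlinarith
end

theorem ap_asym (a b d M K μ : ℝ) (ha : 0 ≤ a) (hb : 0 ≤ b) (hd : 0 ≤ d) (hM : 0 ≤ M)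
    (hK : 0 ≤ K) (hμ0 : 0 ≤ μ) (hμ1 : μ < 1) :
    ∃ D : ℝ, ∃ N : ℕ, ∀ n : ℕ, N ≤ n → ∀ C : ℝ, 0 ≤ C → C ≤ d / n →
      M * ((1 + a * C) ^ 2 * Real.exp (b * n * C ^ 2) - 1) + K * μ ^ n ≤ D / n := by
  have ht := tendsto_self_mul_const_pow_of_lt_one hμ0 hμ1
  obtain ⟨N, hN⟩ := Filter.eventually_atTop.1 (ht.eventually_le_const (zero_lt_one))
  set α := 2 * a * d + a ^ 2 * d ^ 2 with hα
  set γ := b * d ^ 2 * Real.exp (b * d ^ 2) with hγ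
  have hα0 : 0 ≤ α := by positivity
  have hγ0 : 0 ≤ γ := by positivity
  refine ⟨M * (α + γ + α * γ) + K, N + 1, fun n hn C hC0 hC => ?_⟩
  have hn1 : (1 : ℝ) ≤ n := by exact_mod_cast (by omega : 1 ≤ n)
  have hnp : (0 : ℝ) < n := by linarith
  obtain ⟨t, htd⟩ : ∃ t : ℝ, t = 1 / n := ⟨_, rfl⟩
  have ht0 : 0 ≤ t := by rw [htd]; positivity
  have ht1 : t ≤ 1 := by rw [htd, div_le_one hnp]; exact hn1
  have hnt : (n : ℝ) * t = 1 := by rw [htd]; field_simp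
  have hCt : C ≤ d * t := by rw [htd]; simpa [div_eq_mul_inv] using hC
  have e1 : (1 + a * C) ^ 2 ≤ 1 + α * t := by
    calc (1 + a * C) ^ 2 ≤ (1 + a * (d * t)) ^ 2 := by gcongr
      _ = 1 + 2 * a * d * t + a ^ 2 * d ^ 2 * (t * t) := by ring
      _ ≤ 1 + 2 * a * d * t + a ^ 2 * d ^ 2 * (t * 1) := by gcongr
      _ = _ := by rw [hα]; ring
  have e2 : Real.exp (b * n * C ^ 2) ≤ 1 + γ * t := by
    calc Real.exp (b * n * C ^ 2) ≤ Real.exp (b * n * (d * t) ^ 2) := by gcongr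
      _ = Real.exp (b * d ^ 2 * t) := by
        congr 1
        calc _ = b * d ^ 2 * t * (n * t) := by ring
          _ = _ := by rw [hnt, mul_one]
      _ ≤ 1 + (b * d ^ 2 * t) * Real.exp (b * d ^ 2 * t) := by
        have h := Real.add_one_le_exp (-(b * d ^ 2 * t))
        have h' := Real.exp_pos (b * d ^ 2 * t)
        have h'' : Real.exp (-(b * d ^ 2 * t)) * Real.exp (b * d ^ 2 * t) = 1 := by
          rw [← Real.exp_add]; simp
        nlinarith
      _ ≤ 1 + (b * d ^ 2 * t) * Real.exp (b * d ^ 2 * 1) := by gcongr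
      _ = _ := by rw [hγ, mul_one]; ring
  have e3 : μ ^ n ≤ t := by
    rw [htd, le_div_iff₀ hnp, mul_comm]
    exact hN n (by omega)
  have e4 : (1 + a * C) ^ 2 * Real.exp (b * n * C ^ 2) ≤ (1 + α * t) * (1 + γ * t) := by
    gcongr
  have e5 : (1 + α * t) * (1 + γ * t) - 1 ≤ (α + γ + α * γ) * t := by
    have : α * γ * (t * t) ≤ α * γ * (t * 1) := by gcongr
    nlinarith
  calc _ ≤ M * ((α + γ + α * γ) * t) + K * t := by
        gcongr; linarith
    _ = _ := by rw [htd]; ring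

/-- Asymptotic projection of a sequence of operators: if `(E_n)` asymptotically commutes
with a projection `P` at rate `O(1/n)`, the powers of `P E_n P` are uniformly bounded by
`M`, and `(E_n − P E_n P)^k` decays like `K μ^k` with `μ < 1`, then
`‖E_n^n − (P E_n P)^n‖ = O(1/n)`; explicitly, with
`C_n = max{‖E_n' P‖, ‖P E_n'‖}` (`E_n' = E_n − P E_n P`), it is bounded by
`M[(1 + (K/(1−μ))C_n)² e^{(MK/(1−μ)) n C_n²} − 1] + K μⁿ`. -/
theorem asymptotic_projection_of_sequence
    {V : Type*} [NormedAddCommGroup V] [NormedSpace ℂ V] [FiniteDimensional ℂ V]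
    (E : ℕ → V →L[ℂ] V) (P : V →L[ℂ] V) (hP : P * P = P)
    (c : ℝ) (n₁ : ℕ) (h1 : ∀ n : ℕ, n₁ ≤ n → ‖P * E n - E n * P‖ ≤ c / n)
    (M : ℝ) (hM : 0 ≤ M) (K : ℝ) (hK : 0 ≤ K)
    (μ : ℝ) (hμ0 : 0 ≤ μ) (hμ1 : μ < 1) (n₀ : ℕ)
    (h2 : ∀ n : ℕ, n₀ ≤ n → ∀ k : ℕ, ‖(P * E n * P) ^ k‖ ≤ M)
    (h3 : ∀ n : ℕ, n₀ ≤ n → ∀ k : ℕ, ‖(E n - P * E n * P) ^ k‖ ≤ K * μ ^ k) :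
    (∀ n : ℕ, n₀ ≤ n →
      ‖(E n) ^ n - (P * E n * P) ^ n‖ ≤
        M * ((1 + (K / (1 - μ)) *
              max ‖(E n - P * E n * P) * P‖ ‖P * (E n - P * E n * P)‖) ^ 2 *
            Real.exp ((M * K / (1 - μ)) * n *
              (max ‖(E n - P * E n * P) * P‖ ‖P * (E n - P * E n * P)‖) ^ 2) - 1)
          + K * μ ^ n) ∧
    ∃ C : ℝ, ∃ n₂ : ℕ, ∀ n : ℕ, n₂ ≤ n →
      ‖(E n) ^ n - (P * E n * P) ^ n‖ ≤ C / n := by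
  have hdec : ∀ n, E n = P * E n * P + (E n - P * E n * P) := fun n => by abel
  have main : ∀ n : ℕ, n₀ ≤ n →
      ‖(E n) ^ n - (P * E n * P) ^ n‖ ≤
        M * ((1 + (K / (1 - μ)) *
              max ‖(E n - P * E n * P) * P‖ ‖P * (E n - P * E n * P)‖) ^ 2 *
            Real.exp ((M * K / (1 - μ)) * n *
              (max ‖(E n - P * E n * P) * P‖ ‖P * (E n - P * E n * P)‖) ^ 2) - 1)
          + K * μ ^ n := by
    intro n hn
    have h := ap_main (P * E n * P) (E n - P * E n * P) P
      (by rw [mul_assoc, hP]) (by rw [← mul_assoc, ← mul_assoc, hP])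
      (by rw [mul_sub, sub_mul, ← mul_assoc, ← mul_assoc, hP, mul_assoc (P * E n), hP, sub_self])
      M K μ _ hM hK hμ0 hμ1 (le_max_of_le_left (norm_nonneg _)) (h2 n hn) (h3 n hn)
      (le_max_left _ _) (le_max_right _ _) n
    rwa [← hdec n] at h
  refine ⟨main, ?_⟩
  obtain ⟨D, N, hD⟩ := ap_asym (K / (1 - μ)) (M * K / (1 - μ)) (|c| * ‖P‖) M K μ
    (div_nonneg hK (by linarith)) (div_nonneg (mul_nonneg hM hK) (by linarith)) (by positivity)
    hM hK hμ0 hμ1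
  refine ⟨D, max N (max n₀ n₁), fun n hn => ?_⟩
  have hn' : N ≤ n ∧ n₀ ≤ n ∧ n₁ ≤ n := by
    simpa using hn
  refine (main n hn'.2.1).trans (hD n hn'.1 _ (le_max_of_le_left (norm_nonneg _)) ?_)
  have hc : ‖P * E n - E n * P‖ ≤ |c| / n :=
    (h1 n hn'.2.2).trans (by gcongr; exact le_abs_self c)
  refine max_le ?_ ?_
  · have : (E n - P * E n * P) * P = -((P * E n - E n * P) * P) := by
      rw [sub_mul, sub_mul, mul_assoc (P * E n), mul_assoc (E n), hP]; abel
    rw [this, norm_neg]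
    refine (norm_mul_le _ _).trans ?_
    calc _ ≤ |c| / n * ‖P‖ := by gcongr
      _ = _ := by ring
  · have : P * (E n - P * E n * P) = P * (P * E n - E n * P) := by
      simp only [mul_sub, ← mul_assoc, hP]
    rw [this]
    refine (norm_mul_le _ _).trans ?_
    calc _ ≤ ‖P‖ * (|c| / n) := by gcongr
      _ = _ := by ring
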